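/- If G is a threshold graph on d−1 vertices, then the Hansen polytope H(G) ⊆ ℝ^d has exactly 3^d nonempty faces; in particular H(G) satisfies Kalai's 3^d-conjecture with equality. -/

import Mathlib

/-- A finset of vertices is stable (independent) in `G` if no two of its elements are adjacent. -/
def IsStable {n : ℕ} (G : SimpleGraph (Fin n)) (I : Finset (Fin n)) : Prop :=
  ∀ ⦃a⦄, a ∈ I → ∀ ⦃b⦄, b ∈ I → ¬ G.Adj a b

/-- The point `e_0 + ∑_{i ∈ I} e_i ∈ ℝ^{n+1}`. -/
def hansenVert {n : ℕ} (I : Finset (Fin n)) : Fin (n + 1) → ℝ :=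
  fun j => Fin.cases 1 (fun i => if i ∈ I then 1 else 0) j

/-- The Hansen polytope of `G`. -/
def hansenPolytope {n : ℕ} (G : SimpleGraph (Fin n)) : Set (Fin (n + 1) → ℝ) :=
  convexHull ℝ
    {x | ∃ I : Finset (Fin n), IsStable G I ∧ (x = hansenVert I ∨ x = -hansenVert I)}

/-- Threshold graphs: obtainable from the empty graph by repeatedly adding an isolated
vertex or a dominating vertex (up to isomorphism of labelled graphs on `Fin n`). -/
inductive IsThresholdGraph : {n : ℕ} → SimpleGraph (Fin n) → Prop
  | empty : IsThresholdGraph (⊥ : SimpleGraph (Fin 0))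
  | addIsolated {n : ℕ} {G : SimpleGraph (Fin n)} :
      IsThresholdGraph G → IsThresholdGraph (G.map Fin.castSuccEmb)
  | addDominating {n : ℕ} {G : SimpleGraph (Fin n)} :
      IsThresholdGraph G → IsThresholdGraph ((Gᶜ.map Fin.castSuccEmb)ᶜ)
  | iso {n : ℕ} {G G' : SimpleGraph (Fin n)} :
      IsThresholdGraph G → (G ≃g G') → IsThresholdGraph G'

/-- The number of nonempty (exposed) faces of a polytope `P ⊆ ℝ^d`, including `P` itself
(which is the face given by the zero functional). -/
noncomputable def numFaces {d : ℕ} (P : Set (Fin d → ℝ)) : ℕ :=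
  {F : Set (Fin d → ℝ) | IsExposed ℝ P F ∧ F.Nonempty}.ncard

section Faces

variable {E F : Type*} [AddCommGroup E] [Module ℝ E] [AddCommGroup F] [Module ℝ F]

/-- The maximizers of a linear functional over a set. -/
def maximizers (V : Set E) (l : E →ₗ[ℝ] ℝ) : Set E :=
  {x | x ∈ V ∧ ∀ y ∈ V, l y ≤ l x}

/-- The nonempty subsets of `V` cut out by maximizing a linear functional over `V`. -/
def exposedSubsets (V : Set E) : Set (Set E) :=
  {A | A.Nonempty ∧ ∃ l : E →ₗ[ℝ] ℝ, A = maximizers V l}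

/-- The subsets of `V` cut out by a linear inequality `l ≤ 1` valid on `V`. -/
def properSubsets (V : Set E) : Set (Set E) :=
  {A | ∃ l : E →ₗ[ℝ] ℝ, (∀ x ∈ V, l x ≤ 1) ∧ A = {x | x ∈ V ∧ l x = 1}}

theorem maximizers_convexHull {V : Set E} (l : E →ₗ[ℝ] ℝ) :
    maximizers (convexHull ℝ V) l = convexHull ℝ (maximizers V l) := by
  have bound : ∀ c : ℝ, (∀ y ∈ V, l y ≤ c) → ∀ y ∈ convexHull ℝ V, l y ≤ c := fun c hc =>
    convexHull_min hc (convex_halfSpace_le l.isLinear c)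
  apply Set.Subset.antisymm
  · rintro x ⟨hx, hmax⟩
    rw [mem_convexHull_iff_exists_fintype] at hx
    obtain ⟨ι, _, w, z, hw, hw1, hz, rfl⟩ := hx
    set x := ∑ i, w i • z i with hxdef
    have hle : ∀ i, l (z i) ≤ l x := fun i => hmax _ (subset_convexHull ℝ V (hz i))
    have hsum : ∑ i, w i * (l x - l (z i)) = 0 := by
      have : ∑ i, w i * l (z i) = l x := by simp [hxdef]
      simp_rw [mul_sub]
      rw [Finset.sum_sub_distrib, ← Finset.sum_mul, hw1, this]
      ring
    have hzero := (Finset.sum_eq_zero_iff_of_nonneg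
      (fun i _ => mul_nonneg (hw i) (sub_nonneg.2 (hle i)))).1 hsum
    rw [hxdef, ← Finset.sum_filter_of_ne (p := fun i => w i ≠ 0)
      (fun i _ hi h0 => hi (by simp [h0]))]
    refine (convex_convexHull ℝ _).sum_mem (fun i _ => hw i) ?_ ?_
    · rw [Finset.sum_filter_ne_zero, hw1]
    · intro i hi
      refine subset_convexHull ℝ _ ⟨hz i, fun y hy => ?_⟩
      have h1 := hzero i (Finset.mem_univ i)
      have h2 := (mul_eq_zero.1 h1).resolve_left (Finset.mem_filter.1 hi).2
      have h3 := hmax y (subset_convexHull ℝ V hy)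
      linarith
  · intro x hx
    refine ⟨convexHull_mono (fun y hy => hy.1) hx, bound _ fun y hy => ?_⟩
    exact convexHull_min (t := {z | l y ≤ l z}) (fun z hz => hz.2 y hy)
      (convex_halfSpace_ge l.isLinear _) hx

theorem convexHull_inter_of_mem_exposedSubsets {V A : Set E} (hA : A ∈ exposedSubsets V) :
    convexHull ℝ A ∩ V = A := by
  obtain ⟨-, l, rfl⟩ := hA
  rw [← maximizers_convexHull]
  apply Set.Subset.antisymm
  · rintro x ⟨⟨-, h⟩, hx⟩
    exact ⟨hx, fun y hy => h y (subset_convexHull ℝ V hy)⟩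
  · rintro x hx
    refine ⟨?_, hx.1⟩
    rw [maximizers_convexHull]
    exact subset_convexHull ℝ _ hx

theorem ncard_exposedSubsets_convexHull (V : Set E) :
    (exposedSubsets (convexHull ℝ V)).ncard = (exposedSubsets V).ncard := by
  have himage : exposedSubsets (convexHull ℝ V) = convexHull ℝ '' exposedSubsets V := by
    ext A
    constructor
    · rintro ⟨hne, l, rfl⟩
      rw [maximizers_convexHull] at hne ⊢
      exact ⟨_, ⟨convexHull_nonempty_iff.1 hne, l, rfl⟩, rfl⟩
    · rintro ⟨_, ⟨hne, l, rfl⟩, rfl⟩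
      exact ⟨convexHull_nonempty_iff.2 hne, l, (maximizers_convexHull l).symm⟩
  rw [himage]
  refine Set.InjOn.ncard_image fun A hA B hB h => ?_
  rw [← convexHull_inter_of_mem_exposedSubsets hA, h, convexHull_inter_of_mem_exposedSubsets hB]

theorem ncard_exposedSubsets_image {f : E →ₗ[ℝ] F} (hf : Function.Injective f) (V : Set E) :
    (exposedSubsets (f '' V)).ncard = (exposedSubsets V).ncard := by
  have hmax : ∀ l : F →ₗ[ℝ] ℝ, maximizers (f '' V) l = f '' maximizers V (l ∘ₗ f) := by
    intro l
    ext x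
    constructor
    · rintro ⟨⟨y, hy, rfl⟩, h⟩
      exact ⟨y, ⟨hy, fun z hz => h _ ⟨z, hz, rfl⟩⟩, rfl⟩
    · rintro ⟨y, ⟨hy, h⟩, rfl⟩
      refine ⟨⟨y, hy, rfl⟩, ?_⟩
      rintro _ ⟨z, hz, rfl⟩
      exact h z hz
  obtain ⟨g, hg⟩ := LinearMap.exists_leftInverse_of_injective f (LinearMap.ker_eq_bot.2 hf)
  have himage : exposedSubsets (f '' V) = (fun A => f '' A) '' exposedSubsets V := by
    ext A
    constructor
    · rintro ⟨hne, l, rfl⟩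
      rw [hmax] at hne ⊢
      exact ⟨_, ⟨hne.of_image, l ∘ₗ f, rfl⟩, rfl⟩
    · rintro ⟨_, ⟨hne, l, rfl⟩, rfl⟩
      refine ⟨hne.image _, l ∘ₗ g, ?_⟩
      rw [hmax, LinearMap.comp_assoc, hg, LinearMap.comp_id]
  rw [himage]
  exact Set.ncard_image_of_injective _ hf.image_injective

theorem ncard_exposedSubsets_prod (V : Set E) (W : Set F) :
    (exposedSubsets (V ×ˢ W)).ncard = (exposedSubsets V).ncard * (exposedSubsets W).ncard := by
  have himage : exposedSubsets (V ×ˢ W) =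
      (fun p : Set E × Set F => p.1 ×ˢ p.2) '' (exposedSubsets V ×ˢ exposedSubsets W) := by
    ext A
    constructor
    · rintro ⟨⟨⟨x, y⟩, hxy⟩, l, rfl⟩
      obtain ⟨⟨hx, hy⟩, h⟩ := hxy
      have hl : ∀ a b, l (a, b) = l (a, 0) + l (0, b) := fun a b => by
        rw [← map_add]; simp
      refine ⟨(maximizers V (l ∘ₗ LinearMap.inl ℝ E F), maximizers W (l ∘ₗ LinearMap.inr ℝ E F)),
        ⟨⟨⟨x, hx, fun z hz => ?_⟩, _, rfl⟩, ⟨⟨y, hy, fun z hz => ?_⟩, _, rfl⟩⟩, ?_⟩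
      · have := h (z, y) ⟨hz, hy⟩
        rw [hl z, hl x] at this
        simpa using this
      · have := h (x, z) ⟨hx, hz⟩
        rw [hl x z, hl x y] at this
        simpa using this
      · ext ⟨a, b⟩
        constructor
        · rintro ⟨⟨ha, h1⟩, ⟨hb, h2⟩⟩
          refine ⟨⟨ha, hb⟩, fun z hz => ?_⟩
          have h1' := h1 z.1 hz.1
          have h2' := h2 z.2 hz.2
          simp only [LinearMap.comp_apply, LinearMap.inl_apply, LinearMap.inr_apply] at h1' h2'
          have := hl z.1 z.2
          rw [Prod.mk.eta] at this
          rw [this, hl a b]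
          linarith
        · rintro ⟨⟨ha, hb⟩, h3⟩
          refine ⟨⟨ha, fun z hz => ?_⟩, ⟨hb, fun z hz => ?_⟩⟩
          · have := h3 (z, b) ⟨hz, hb⟩
            rw [hl z, hl a] at this
            simpa using this
          · have := h3 (a, z) ⟨ha, hz⟩
            rw [hl a z, hl a b] at this
            simpa using this
    · rintro ⟨⟨_, _⟩, ⟨⟨hA, l, rfl⟩, ⟨hB, m, rfl⟩⟩, rfl⟩
      refine ⟨hA.prod hB, l.coprod m, ?_⟩
      obtain ⟨x, hx, -⟩ := hA
      obtain ⟨y, hy, -⟩ := hB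
      ext ⟨a, b⟩
      constructor
      · rintro ⟨⟨ha, h1⟩, ⟨hb, h2⟩⟩
        exact ⟨⟨ha, hb⟩, fun z hz => by simpa using add_le_add (h1 _ hz.1) (h2 _ hz.2)⟩
      · rintro ⟨⟨ha, hb⟩, h3⟩
        exact ⟨⟨ha, fun z hz => by simpa using h3 (z, b) ⟨hz, hb⟩⟩,
          ⟨hb, fun z hz => by simpa using h3 (a, z) ⟨ha, hz⟩⟩⟩
  rw [himage, Set.InjOn.ncard_image, Set.ncard_prod]
  rintro ⟨A, B⟩ ⟨hA, hB⟩ ⟨C, D⟩ - h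
  have := (Set.prod_eq_prod_iff_of_nonempty (hA.1.prod hB.1)).1 h
  exact Prod.ext this.1 this.2

theorem zero_notMem_of_mem_properSubsets {V A : Set E} (hA : A ∈ properSubsets V) :
    (0 : E) ∉ A := by
  obtain ⟨l, -, rfl⟩ := hA
  rintro ⟨-, h⟩
  simp at h

/-- The vertices of the free sum of two polytopes, from their vertices. -/
def freeSum (V : Set E) (W : Set F) : Set (E × F) :=
  LinearMap.inl ℝ E F '' V ∪ LinearMap.inr ℝ E F '' W

theorem ncard_properSubsets_freeSum (V : Set E) (W : Set F) :
    (properSubsets (freeSum V W)).ncard =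
      (properSubsets V).ncard * (properSubsets W).ncard := by
  have hcut : ∀ l : E × F →ₗ[ℝ] ℝ, {x | x ∈ freeSum V W ∧ l x = 1} =
      freeSum {x | x ∈ V ∧ (l ∘ₗ LinearMap.inl ℝ E F) x = 1}
        {x | x ∈ W ∧ (l ∘ₗ LinearMap.inr ℝ E F) x = 1} := by
    intro l
    ext z
    constructor
    · rintro ⟨⟨x, hx, rfl⟩ | ⟨x, hx, rfl⟩, h⟩
      · exact Or.inl ⟨x, ⟨hx, h⟩, rfl⟩
      · exact Or.inr ⟨x, ⟨hx, h⟩, rfl⟩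
    · rintro (⟨x, ⟨hx, h⟩, rfl⟩ | ⟨x, ⟨hx, h⟩, rfl⟩)
      · exact ⟨Or.inl ⟨x, hx, rfl⟩, h⟩
      · exact ⟨Or.inr ⟨x, hx, rfl⟩, h⟩
  have himage : properSubsets (freeSum V W) =
      (fun p : Set E × Set F => freeSum p.1 p.2) '' (properSubsets V ×ˢ properSubsets W) := by
    ext A
    constructor
    · rintro ⟨l, hl, rfl⟩
      refine ⟨(_, _), ⟨⟨l ∘ₗ LinearMap.inl ℝ E F, fun x hx => hl _ (Or.inl ⟨x, hx, rfl⟩), rfl⟩,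
        ⟨l ∘ₗ LinearMap.inr ℝ E F, fun x hx => hl _ (Or.inr ⟨x, hx, rfl⟩), rfl⟩⟩, ?_⟩
      exact (hcut l).symm
    · rintro ⟨⟨_, _⟩, ⟨⟨l, hl, rfl⟩, ⟨m, hm, rfl⟩⟩, rfl⟩
      refine ⟨l.coprod m, ?_, ?_⟩
      · rintro _ (⟨x, hx, rfl⟩ | ⟨x, hx, rfl⟩)
        · simpa using hl x hx
        · simpa using hm x hx
      · rw [hcut, LinearMap.coprod_inl, LinearMap.coprod_inr]
  rw [himage, Set.InjOn.ncard_image, Set.ncard_prod]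
  have hfst : ∀ {A : Set E} {B : Set F}, (0 : F) ∉ B →
      ∀ x, (x, (0 : F)) ∈ freeSum A B ↔ x ∈ A := by
    intro A B hB x
    constructor
    · rintro (⟨y, hy, h⟩ | ⟨y, hy, h⟩)
      · simp only [LinearMap.inl_apply, Prod.mk.injEq] at h
        exact h.1 ▸ hy
      · simp only [LinearMap.inr_apply, Prod.mk.injEq] at h
        exact absurd (h.2 ▸ hy) hB
    · exact fun hx => Or.inl ⟨x, hx, rfl⟩
  have hsnd : ∀ {A : Set E} {B : Set F}, (0 : E) ∉ A →
      ∀ x, ((0 : E), x) ∈ freeSum A B ↔ x ∈ B := by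
    intro A B hA x
    constructor
    · rintro (⟨y, hy, h⟩ | ⟨y, hy, h⟩)
      · simp only [LinearMap.inl_apply, Prod.mk.injEq] at h
        exact absurd (h.1 ▸ hy) hA
      · simp only [LinearMap.inr_apply, Prod.mk.injEq] at h
        exact h.2 ▸ hy
    · exact fun hx => Or.inr ⟨x, hx, rfl⟩
  rintro ⟨A, B⟩ ⟨hA, hB⟩ ⟨C, D⟩ ⟨hC, hD⟩ h
  have h' : freeSum A B = freeSum C D := h
  refine Prod.ext (Set.ext fun x => ?_) (Set.ext fun x => ?_)
  · change x ∈ A ↔ x ∈ C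
    rw [← hfst (zero_notMem_of_mem_properSubsets hB) x, h',
      hfst (zero_notMem_of_mem_properSubsets hD) x]
  · change x ∈ B ↔ x ∈ D
    rw [← hsnd (zero_notMem_of_mem_properSubsets hA) x, h',
      hsnd (zero_notMem_of_mem_properSubsets hC) x]

theorem ncard_exposedSubsets_eq_ncard_properSubsets {V : Set E} (hfin : V.Finite)
    (hne : V.Nonempty) (hsymm : ∀ x ∈ V, -x ∈ V) :
    (exposedSubsets V).ncard = (properSubsets V).ncard := by
  have hempty : (∅ : Set E) ∈ properSubsets V := ⟨0, by simp, by simp⟩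
  have hV : V ∉ properSubsets V := by
    rintro ⟨l, -, h⟩
    obtain ⟨x, hx⟩ := hne
    have h1 : l x = 1 := (h.subset hx).2
    have h2 : l (-x) = 1 := (h.subset (hsymm x hx)).2
    rw [map_neg] at h2
    linarith
  have hpfin : (properSubsets V).Finite := hfin.finite_subsets.subset (by
    rintro _ ⟨l, -, rfl⟩ x hx
    exact hx.1)
  have heq : exposedSubsets V = insert V (properSubsets V \ {∅}) := by
    ext A
    constructor
    · rintro ⟨hA, l, rfl⟩
      obtain ⟨x, hx, hmax⟩ := hA
      have h0 : 0 ≤ l x := by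
        have := hmax _ (hsymm x hx)
        rw [map_neg] at this
        linarith
      rcases h0.eq_or_lt with h0 | h0
      · left
        have hl : ∀ y ∈ V, l y = 0 := fun y hy => by
          have h1 := hmax y hy
          have h2 := hmax _ (hsymm y hy)
          rw [map_neg] at h2
          linarith
        ext y
        exact ⟨fun hy => hy.1, fun hy => ⟨hy, fun z hz => by rw [hl y hy, hl z hz]⟩⟩
      · right
        refine ⟨⟨(l x)⁻¹ • l, fun y hy => ?_, ?_⟩, ?_⟩
        · rw [LinearMap.smul_apply, smul_eq_mul, inv_mul_le_one₀ h0]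
          exact hmax y hy
        · ext y
          constructor
          · rintro ⟨hy, h⟩
            refine ⟨hy, ?_⟩
            rw [LinearMap.smul_apply, smul_eq_mul, inv_mul_eq_one₀ h0.ne']
            exact le_antisymm (h x hx) (hmax y hy)
          · rintro ⟨hy, h⟩
            rw [LinearMap.smul_apply, smul_eq_mul, inv_mul_eq_one₀ h0.ne'] at h
            exact ⟨hy, fun z hz => h ▸ hmax z hz⟩
        · exact Set.Nonempty.ne_empty ⟨x, hx, hmax⟩
    · rintro (rfl | ⟨⟨l, hl, rfl⟩, hA⟩)
      · exact ⟨hne, 0, by ext; simp [maximizers]⟩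
      · obtain ⟨x, hx, hx1⟩ := Set.nonempty_iff_ne_empty.2 hA
        refine ⟨⟨x, hx, hx1⟩, l, ?_⟩
        ext y
        constructor
        · rintro ⟨hy, h⟩
          exact ⟨hy, fun z hz => h ▸ hl z hz⟩
        · rintro ⟨hy, h⟩
          exact ⟨hy, le_antisymm (hl y hy) (hx1 ▸ h x hx)⟩
  rw [heq, Set.ncard_insert_of_notMem (fun h => hV h.1) hpfin.sdiff,
    Set.ncard_sdiff_singleton_add_one hempty hpfin]

theorem ncard_properSubsets_unit_signs : (properSubsets ({1, -1} : Set ℝ)).ncard = 3 := by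
  have heq : properSubsets ({1, -1} : Set ℝ) = {∅, {1}, {-1}} := by
    ext A
    constructor
    · rintro ⟨l, hl, rfl⟩
      have hneg : l (-1) = -l 1 := map_neg l 1
      by_cases h1 : l 1 = 1
      · right; left
        ext x
        constructor
        · rintro ⟨rfl | rfl, h⟩
          · rfl
          · rw [hneg] at h; linarith
        · rintro rfl
          exact ⟨Or.inl rfl, h1⟩
      · by_cases h2 : l (-1) = 1
        · right; right
          ext x
          constructor
          · rintro ⟨rfl | rfl, h⟩
            · exact absurd h h1
            · rfl
          · rintro rfl
            exact ⟨Or.inr rfl, h2⟩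
        · left
          refine Set.eq_empty_of_forall_notMem ?_
          rintro x ⟨rfl | rfl, h⟩
          · exact h1 h
          · exact h2 h
    · rintro (rfl | rfl | rfl)
      · exact ⟨0, by simp, by simp⟩
      · refine ⟨LinearMap.id, ?_, ?_⟩
        · rintro x (rfl | rfl) <;> norm_num
        · ext x
          constructor
          · rintro rfl; exact ⟨Or.inl rfl, rfl⟩
          · rintro ⟨-, h⟩; exact h
      · refine ⟨-LinearMap.id, ?_, ?_⟩
        · rintro x (rfl | rfl) <;> norm_num
        · ext x
          constructor
          · rintro rfl; exact ⟨Or.inr rfl, by simp⟩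
          · rintro ⟨-, h⟩
            have h' : -x = 1 := h
            exact Set.mem_singleton_iff.2 (by linarith)
  rw [heq, Set.ncard_eq_three]
  refine ⟨_, _, _, (Set.singleton_ne_empty _).symm, (Set.singleton_ne_empty _).symm, ?_, rfl⟩
  rw [Ne, Set.singleton_eq_singleton_iff]
  norm_num

theorem ncard_exposedSubsets_unit_signs : (exposedSubsets ({1, -1} : Set ℝ)).ncard = 3 := by
  rw [ncard_exposedSubsets_eq_ncard_properSubsets (Set.toFinite _) (Set.insert_nonempty _ _),
    ncard_properSubsets_unit_signs]
  rintro x (rfl | rfl) <;> simp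

theorem ncard_exposedSubsets_freeSum_unit_signs {V : Set E} (hfin : V.Finite)
    (hne : V.Nonempty) (hsymm : ∀ x ∈ V, -x ∈ V) :
    (exposedSubsets (freeSum V ({1, -1} : Set ℝ))).ncard = (exposedSubsets V).ncard * 3 := by
  rw [ncard_exposedSubsets_eq_ncard_properSubsets, ncard_properSubsets_freeSum,
    ncard_properSubsets_unit_signs, ncard_exposedSubsets_eq_ncard_properSubsets hfin hne hsymm]
  · exact (hfin.image _).union ((Set.toFinite _).image _)
  · exact (hne.image _).inl
  · rintro _ (⟨x, hx, rfl⟩ | ⟨x, hx, rfl⟩)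
    · exact Or.inl ⟨-x, hsymm x hx, map_neg _ _⟩
    · refine Or.inr ⟨-x, ?_, map_neg _ _⟩
      rcases hx with rfl | rfl <;> simp

end Faces

theorem numFaces_eq_ncard_exposedSubsets {d : ℕ} (P : Set (Fin d → ℝ)) :
    numFaces P = (exposedSubsets P).ncard := by
  unfold numFaces
  congr 1
  ext A
  constructor
  · rintro ⟨hA, hne⟩
    obtain ⟨l, rfl⟩ := hA hne
    exact ⟨hne, l, rfl⟩
  · rintro ⟨hne, l, rfl⟩
    exact ⟨fun _ => ⟨LinearMap.toContinuousLinearMap l, rfl⟩, hne⟩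

section Hansen

variable {n : ℕ}

/-- The points whose convex hull is the Hansen polytope. -/
def hansenPoints (G : SimpleGraph (Fin n)) : Set (Fin (n + 1) → ℝ) :=
  {x | ∃ I : Finset (Fin n), IsStable G I ∧ (x = hansenVert I ∨ x = -hansenVert I)}

@[simp] theorem hansenVert_zero (I : Finset (Fin n)) : hansenVert I 0 = 1 := rfl

@[simp] theorem hansenVert_succ (I : Finset (Fin n)) (i : Fin n) :
    hansenVert I i.succ = if i ∈ I then 1 else 0 := rfl

theorem hansenPoints_finite (G : SimpleGraph (Fin n)) : (hansenPoints G).Finite := by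
  refine ((Set.finite_range hansenVert).union (Set.finite_range (-hansenVert))).subset ?_
  rintro x ⟨I, -, rfl | rfl⟩
  · exact Or.inl ⟨I, rfl⟩
  · exact Or.inr ⟨I, rfl⟩

theorem isStable_empty (G : SimpleGraph (Fin n)) : IsStable G ∅ := by
  simp [IsStable]

theorem hansenPoints_nonempty (G : SimpleGraph (Fin n)) : (hansenPoints G).Nonempty :=
  ⟨_, ∅, isStable_empty G, Or.inl rfl⟩

theorem neg_mem_hansenPoints (G : SimpleGraph (Fin n)) :
    ∀ x ∈ hansenPoints G, -x ∈ hansenPoints G := by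
  rintro x ⟨I, hI, rfl | rfl⟩
  · exact ⟨I, hI, Or.inr rfl⟩
  · exact ⟨I, hI, Or.inl (neg_neg _)⟩

theorem hansenVert_mem_hansenPoints {G : SimpleGraph (Fin n)} {I : Finset (Fin n)}
    (hI : IsStable G I) : hansenVert I ∈ hansenPoints G :=
  ⟨I, hI, Or.inl rfl⟩

/-- A symmetric set is mapped onto the Hansen points as soon as each vertex `hansenVert I` is hit
and a set of representatives up to sign is mapped into the Hansen points. -/
theorem image_eq_hansenPoints {E : Type*} [AddCommGroup E] [Module ℝ E]
    (G : SimpleGraph (Fin n)) (f : E →ₗ[ℝ] (Fin (n + 1) → ℝ)) {V : Set E}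
    (hsymm : ∀ x ∈ V, -x ∈ V) (hmaps : ∀ x ∈ V, f x ∈ hansenPoints G ∨ f (-x) ∈ hansenPoints G)
    (hsurj : ∀ I, IsStable G I → ∃ x ∈ V, f x = hansenVert I) :
    f '' V = hansenPoints G := by
  apply Set.Subset.antisymm
  · rintro _ ⟨x, hx, rfl⟩
    rcases hmaps x hx with h | h
    · exact h
    · simpa using neg_mem_hansenPoints G _ h
  · rintro _ ⟨I, hI, rfl | rfl⟩
    · exact hsurj I hI
    · obtain ⟨x, hx, h⟩ := hsurj I hI
      exact ⟨-x, hsymm x hx, by rw [map_neg, h]⟩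

/-- The linear map carrying the prism over the Hansen polytope of `G` to the Hansen polytope
of `G` with an isolated vertex added. -/
noncomputable def prismMap (n : ℕ) : (Fin (n + 1) → ℝ) × ℝ →ₗ[ℝ] (Fin (n + 2) → ℝ) where
  toFun p := Fin.snoc (α := fun _ => ℝ) p.1 ((p.1 0 + p.2) / 2)
  map_add' p q := by
    ext j
    refine Fin.lastCases ?_ (fun i => ?_) j <;> simp
    ring
  map_smul' c p := by
    ext j
    refine Fin.lastCases ?_ (fun i => ?_) j <;> simp
    ring

/-- The linear map carrying the bipyramid over the Hansen polytope of `G` to the Hansen polytope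
of `G` with a dominating vertex added. -/
noncomputable def bipyramidMap (n : ℕ) : (Fin (n + 1) → ℝ) × ℝ →ₗ[ℝ] (Fin (n + 2) → ℝ) where
  toFun p := Fin.snoc (α := fun _ => ℝ) (p.1 + p.2 • hansenVert ∅) p.2
  map_add' p q := by
    ext j
    refine Fin.lastCases ?_ (fun i => ?_) j <;> simp
    ring
  map_smul' c p := by
    ext j
    refine Fin.lastCases ?_ (fun i => ?_) j <;> simp
    ring

/-- The linear map induced by a permutation of the vertices. -/
def permuteMap (e : Fin n ≃ Fin n) : (Fin (n + 1) → ℝ) →ₗ[ℝ] (Fin (n + 1) → ℝ) where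
  toFun x := Fin.cons (α := fun _ => ℝ) (x 0) (fun i => x (e.symm i).succ)
  map_add' p q := by
    ext j
    refine Fin.cases ?_ (fun i => ?_) j <;> simp
  map_smul' c p := by
    ext j
    refine Fin.cases ?_ (fun i => ?_) j <;> simp

theorem prismMap_injective : Function.Injective (prismMap n) := by
  rintro ⟨x, s⟩ ⟨y, t⟩ h
  have h' : Fin.snoc (α := fun _ => ℝ) x ((x 0 + s) / 2) = Fin.snoc y ((y 0 + t) / 2) := h
  obtain ⟨rfl, h2⟩ := Fin.snoc_injective2 h'
  exact Prod.ext rfl (show s = t by linarith)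

theorem bipyramidMap_injective : Function.Injective (bipyramidMap n) := by
  rintro ⟨x, s⟩ ⟨y, t⟩ h
  have h' : Fin.snoc (α := fun _ => ℝ) (x + s • hansenVert ∅) s =
      Fin.snoc (y + t • hansenVert ∅) t := h
  obtain ⟨h1, rfl⟩ := Fin.snoc_injective2 h'
  exact Prod.ext (add_right_cancel h1) rfl

theorem permuteMap_injective (e : Fin n ≃ Fin n) : Function.Injective (permuteMap e) := by
  intro x y h
  have h' : Fin.cons (α := fun _ => ℝ) (x 0) (fun i => x (e.symm i).succ) =
      Fin.cons (y 0) (fun i => y (e.symm i).succ) := h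
  obtain ⟨h1, h2⟩ := Fin.cons_injective2 h'
  ext j
  refine Fin.cases h1 (fun i => ?_) j
  simpa using congrFun h2 (e i)

theorem prismMap_hansenVert (I : Finset (Fin n)) (J : Finset (Fin (n + 1))) (t : ℝ)
    (hI : ∀ i, i ∈ I ↔ i.castSucc ∈ J) (ht : t = if Fin.last n ∈ J then 1 else -1) :
    prismMap n (hansenVert I, t) = hansenVert J := by
  change Fin.snoc (α := fun _ => ℝ) (hansenVert I) ((hansenVert I 0 + t) / 2) = hansenVert J
  ext j
  refine Fin.lastCases ?_ (fun i => ?_) j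
  · rw [Fin.snoc_last, ← Fin.succ_last, hansenVert_succ, hansenVert_zero, ht]
    split_ifs <;> norm_num
  · rw [Fin.snoc_castSucc]
    refine Fin.cases rfl (fun k => ?_) i
    rw [← Fin.succ_castSucc, hansenVert_succ, hansenVert_succ]
    simp only [hI]

theorem bipyramidMap_hansenVert (I : Finset (Fin n)) (J : Finset (Fin (n + 1)))
    (hI : ∀ i, i ∈ I ↔ i.castSucc ∈ J) (hlast : Fin.last n ∉ J) :
    bipyramidMap n (hansenVert I, 0) = hansenVert J := by
  change Fin.snoc (α := fun _ => ℝ) (hansenVert I + (0 : ℝ) • hansenVert ∅) (0 : ℝ) = hansenVert J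
  ext j
  refine Fin.lastCases ?_ (fun i => ?_) j
  · rw [Fin.snoc_last, ← Fin.succ_last, hansenVert_succ, if_neg hlast]
  · rw [Fin.snoc_castSucc, zero_smul, add_zero]
    refine Fin.cases rfl (fun k => ?_) i
    rw [← Fin.succ_castSucc, hansenVert_succ, hansenVert_succ]
    simp only [hI]

theorem bipyramidMap_apex :
    bipyramidMap n (0, 1) = hansenVert {Fin.last n} := by
  change Fin.snoc (α := fun _ => ℝ) (0 + (1 : ℝ) • hansenVert ∅) (1 : ℝ) = hansenVert {Fin.last n}
  ext j
  refine Fin.lastCases ?_ (fun i => ?_) j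
  · rw [Fin.snoc_last, ← Fin.succ_last, hansenVert_succ, if_pos (Finset.mem_singleton_self _)]
  · rw [Fin.snoc_castSucc, one_smul, zero_add]
    refine Fin.cases rfl (fun k => ?_) i
    rw [← Fin.succ_castSucc, hansenVert_succ, hansenVert_succ]
    simp [Fin.castSucc_ne_last]

theorem permuteMap_hansenVert (e : Fin n ≃ Fin n) (I : Finset (Fin n)) :
    permuteMap e (hansenVert I) = hansenVert (I.map e.toEmbedding) := by
  change Fin.cons (α := fun _ => ℝ) (hansenVert I 0) (fun i => hansenVert I (e.symm i).succ) = _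
  ext j
  refine Fin.cases rfl (fun i => ?_) j
  simp [Finset.mem_map_equiv]

theorem isStable_map_castSucc_iff {G : SimpleGraph (Fin n)} {I : Finset (Fin n)}
    {J : Finset (Fin (n + 1))} (hI : ∀ i, i ∈ I ↔ i.castSucc ∈ J) :
    IsStable (G.map Fin.castSuccEmb) J ↔ IsStable G I := by
  constructor
  · intro h a ha b hb hab
    exact h ((hI a).1 ha) ((hI b).1 hb) ((SimpleGraph.map_adj _ _ _ _).2 ⟨a, b, hab, rfl, rfl⟩)
  · intro h a ha b hb hab
    obtain ⟨a, b, hadj, rfl, rfl⟩ := (SimpleGraph.map_adj _ _ _ _).1 hab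
    exact h ((hI a).2 ha) ((hI b).2 hb) hadj

theorem adj_dominating_castSucc_iff {G : SimpleGraph (Fin n)} {a b : Fin n} :
    ((Gᶜ.map Fin.castSuccEmb)ᶜ).Adj a.castSucc b.castSucc ↔ G.Adj a b := by
  have h : (Gᶜ.map Fin.castSuccEmb).Adj a.castSucc b.castSucc ↔ Gᶜ.Adj a b :=
    SimpleGraph.map_adj_apply (f := Fin.castSuccEmb)
  rw [SimpleGraph.compl_adj, h, SimpleGraph.compl_adj, Ne, Fin.castSucc_inj]
  have := G.ne_of_adj (a := a) (b := b)
  tauto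

theorem adj_dominating_last {G : SimpleGraph (Fin n)} (a : Fin n) :
    ((Gᶜ.map Fin.castSuccEmb)ᶜ).Adj a.castSucc (Fin.last n) := by
  refine (SimpleGraph.compl_adj _ _ _).2 ⟨Fin.castSucc_ne_last a, fun h => ?_⟩
  obtain ⟨_, b, _, _, hb⟩ := (SimpleGraph.map_adj _ _ _ _).1 h
  exact Fin.castSucc_ne_last b hb

theorem isStable_dominating_iff {G : SimpleGraph (Fin n)} {I : Finset (Fin n)}
    {J : Finset (Fin (n + 1))} (hI : ∀ i, i ∈ I ↔ i.castSucc ∈ J) (hlast : Fin.last n ∉ J) :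
    IsStable ((Gᶜ.map Fin.castSuccEmb)ᶜ) J ↔ IsStable G I := by
  constructor
  · intro h a ha b hb hab
    exact h ((hI a).1 ha) ((hI b).1 hb) (adj_dominating_castSucc_iff.2 hab)
  · intro h a ha b hb hab
    obtain ⟨a, rfl⟩ := Fin.exists_castSucc_eq.2 (ne_of_mem_of_not_mem ha hlast)
    obtain ⟨b, rfl⟩ := Fin.exists_castSucc_eq.2 (ne_of_mem_of_not_mem hb hlast)
    exact h ((hI a).2 ha) ((hI b).2 hb) (adj_dominating_castSucc_iff.1 hab)

theorem eq_singleton_last_of_isStable_dominating {G : SimpleGraph (Fin n)}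
    {J : Finset (Fin (n + 1))} (hJ : IsStable ((Gᶜ.map Fin.castSuccEmb)ᶜ) J)
    (hlast : Fin.last n ∈ J) : J = {Fin.last n} := by
  refine Finset.eq_singleton_iff_unique_mem.2 ⟨hlast, fun a ha => ?_⟩
  by_contra hne
  obtain ⟨a, rfl⟩ := Fin.exists_castSucc_eq.2 hne
  exact hJ ha hlast (adj_dominating_last a)

theorem prismMap_image (G : SimpleGraph (Fin n)) :
    prismMap n '' (hansenPoints G ×ˢ {1, -1}) = hansenPoints (G.map Fin.castSuccEmb) := by
  have hsigns : ∀ (I : Finset (Fin n)) (t : ℝ), IsStable G I → t = 1 ∨ t = -1 →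
      prismMap n (hansenVert I, t) ∈ hansenPoints (G.map Fin.castSuccEmb) := by
    rintro I t hI (rfl | rfl)
    · have h : ∀ i, i ∈ I ↔ i.castSucc ∈ insert (Fin.last n) (I.map Fin.castSuccEmb) := by
        simp [Fin.castSucc_ne_last]
      rw [prismMap_hansenVert I _ 1 h (by simp)]
      exact hansenVert_mem_hansenPoints ((isStable_map_castSucc_iff h).2 hI)
    · have h : ∀ i, i ∈ I ↔ i.castSucc ∈ I.map Fin.castSuccEmb := by simp
      rw [prismMap_hansenVert I _ (-1) h (by simp [Fin.castSucc_ne_last])]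
      exact hansenVert_mem_hansenPoints ((isStable_map_castSucc_iff h).2 hI)
  refine image_eq_hansenPoints _ _ ?_ ?_ ?_
  · rintro ⟨x, t⟩ ⟨hx, ht⟩
    refine ⟨neg_mem_hansenPoints G x hx, ?_⟩
    rcases ht with h | h <;> simp_all
  · rintro ⟨x, t⟩ ⟨⟨I, hI, hx⟩, ht⟩
    dsimp only at hx ht
    rcases hx with rfl | rfl
    · exact Or.inl (hsigns I t hI ht)
    · right
      rw [Prod.neg_mk, neg_neg]
      refine hsigns I _ hI ?_
      rcases ht with h | h <;> simp_all
  · intro J hJ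
    have h : ∀ i, i ∈ Finset.univ.filter (fun i : Fin n => i.castSucc ∈ J) ↔ i.castSucc ∈ J := by
      simp
    refine ⟨(hansenVert _, if Fin.last n ∈ J then 1 else -1),
      ⟨hansenVert_mem_hansenPoints ((isStable_map_castSucc_iff h).1 hJ), ?_⟩,
      prismMap_hansenVert _ J _ h rfl⟩
    by_cases hl : Fin.last n ∈ J <;> simp [hl]

theorem bipyramidMap_image (G : SimpleGraph (Fin n)) :
    bipyramidMap n '' freeSum (hansenPoints G) {1, -1} =
      hansenPoints ((Gᶜ.map Fin.castSuccEmb)ᶜ) := by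
  have hbase : ∀ I : Finset (Fin n), IsStable G I →
      bipyramidMap n (hansenVert I, 0) ∈ hansenPoints ((Gᶜ.map Fin.castSuccEmb)ᶜ) := by
    intro I hI
    have h : ∀ i, i ∈ I ↔ i.castSucc ∈ I.map Fin.castSuccEmb := by simp
    have hlast : Fin.last n ∉ I.map Fin.castSuccEmb := by simp [Fin.castSucc_ne_last]
    rw [bipyramidMap_hansenVert I _ h hlast]
    exact hansenVert_mem_hansenPoints ((isStable_dominating_iff h hlast).2 hI)
  have hapex : bipyramidMap n (0, 1) ∈ hansenPoints ((Gᶜ.map Fin.castSuccEmb)ᶜ) := by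
    rw [bipyramidMap_apex]
    refine hansenVert_mem_hansenPoints fun a ha b hb => ?_
    rw [Finset.mem_singleton.1 ha, Finset.mem_singleton.1 hb]
    exact SimpleGraph.irrefl _
  refine image_eq_hansenPoints _ _ ?_ ?_ ?_
  · rintro _ (⟨x, hx, rfl⟩ | ⟨t, ht, rfl⟩)
    · exact Or.inl ⟨-x, neg_mem_hansenPoints G x hx, map_neg _ _⟩
    · refine Or.inr ⟨-t, ?_, map_neg _ _⟩
      rcases ht with rfl | rfl <;> simp
  · rintro _ (⟨x, ⟨I, hI, rfl | rfl⟩, rfl⟩ | ⟨t, rfl | rfl, rfl⟩)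
    · exact Or.inl (hbase I hI)
    · right
      rw [← map_neg, neg_neg]
      exact hbase I hI
    · exact Or.inl hapex
    · right
      rw [← map_neg, neg_neg]
      exact hapex
  · intro J hJ
    by_cases hlast : Fin.last n ∈ J
    · rw [eq_singleton_last_of_isStable_dominating hJ hlast]
      exact ⟨(0, 1), Or.inr ⟨1, Or.inl rfl, rfl⟩, bipyramidMap_apex⟩
    · have h : ∀ i, i ∈ Finset.univ.filter (fun i : Fin n => i.castSucc ∈ J) ↔
          i.castSucc ∈ J := by simp
      exact ⟨(hansenVert _, 0), Or.inl ⟨_, hansenVert_mem_hansenPoints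
        ((isStable_dominating_iff h hlast).1 hJ), rfl⟩, bipyramidMap_hansenVert _ J h hlast⟩

theorem permuteMap_image {G G' : SimpleGraph (Fin n)} (e : G ≃g G') :
    permuteMap e.toEquiv '' hansenPoints G = hansenPoints G' := by
  refine image_eq_hansenPoints _ _ (neg_mem_hansenPoints G) ?_ ?_
  · have hstable : ∀ I, IsStable G I → IsStable G' (I.map e.toEquiv.toEmbedding) := by
      intro I hI a ha b hb hab
      obtain ⟨a, ha', rfl⟩ := Finset.mem_map.1 ha
      obtain ⟨b, hb', rfl⟩ := Finset.mem_map.1 hb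
      exact hI ha' hb' (e.map_adj_iff.1 hab)
    rintro x ⟨I, hI, rfl | rfl⟩
    · left
      rw [permuteMap_hansenVert]
      exact hansenVert_mem_hansenPoints (hstable I hI)
    · right
      rw [neg_neg, permuteMap_hansenVert]
      exact hansenVert_mem_hansenPoints (hstable I hI)
  · intro J hJ
    refine ⟨hansenVert (J.map e.symm.toEquiv.toEmbedding), hansenVert_mem_hansenPoints ?_, ?_⟩
    · intro a ha b hb hab
      obtain ⟨a, ha', rfl⟩ := Finset.mem_map.1 ha
      obtain ⟨b, hb', rfl⟩ := Finset.mem_map.1 hb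
      exact hJ ha' hb' (e.symm.map_adj_iff.1 hab)
    · rw [permuteMap_hansenVert]
      congr 1
      ext i
      rw [Finset.mem_map_equiv, Finset.mem_map_equiv]
      change e (e.symm i) ∈ J ↔ i ∈ J
      rw [e.apply_symm_apply]

theorem ncard_exposedSubsets_hansenPoints_zero (G : SimpleGraph (Fin 0)) :
    (exposedSubsets (hansenPoints G)).ncard = 3 := by
  let f : ℝ →ₗ[ℝ] (Fin 1 → ℝ) := (LinearEquiv.funUnique (Fin 1) ℝ ℝ).symm.toLinearMap
  have hone : f 1 = hansenVert ∅ := by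
    ext j
    rw [Subsingleton.elim j 0]
    rfl
  have himage : f '' {1, -1} = hansenPoints G := by
    refine image_eq_hansenPoints _ _ ?_ ?_ ?_
    · rintro x (rfl | rfl) <;> simp
    · rintro x (rfl | rfl)
      · left
        rw [hone]
        exact hansenVert_mem_hansenPoints (isStable_empty G)
      · right
        rw [neg_neg, hone]
        exact hansenVert_mem_hansenPoints (isStable_empty G)
    · intro I _
      exact ⟨1, Or.inl rfl, by rw [hone, Subsingleton.elim I ∅]⟩
  rw [← himage, ncard_exposedSubsets_image (LinearEquiv.injective _),
    ncard_exposedSubsets_unit_signs]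

theorem IsThresholdGraph.ncard_exposedSubsets_hansenPoints {G : SimpleGraph (Fin n)}
    (hG : IsThresholdGraph G) : (exposedSubsets (hansenPoints G)).ncard = 3 ^ (n + 1) := by
  induction hG with
  | empty => exact ncard_exposedSubsets_hansenPoints_zero _
  | @addIsolated n G _ ih =>
    rw [← prismMap_image, ncard_exposedSubsets_image prismMap_injective,
      ncard_exposedSubsets_prod, ncard_exposedSubsets_unit_signs, ih, ← pow_succ]
  | @addDominating n G _ ih =>
    rw [← bipyramidMap_image, ncard_exposedSubsets_image bipyramidMap_injective,
      ncard_exposedSubsets_freeSum_unit_signs (hansenPoints_finite G) (hansenPoints_nonempty G)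
        (neg_mem_hansenPoints G), ih, ← pow_succ]
  | @iso n G G' _ e ih =>
    rw [← permuteMap_image e, ncard_exposedSubsets_image (permuteMap_injective _), ih]

end Hansen

/-- If `G` is a threshold graph on `d − 1` vertices, then the Hansen polytope
`H(G) ⊆ ℝ^d` has exactly `3^d` nonempty faces (here `d = n + 1`). -/
theorem hansen_threshold_faces {n : ℕ} (G : SimpleGraph (Fin n))
    (hG : IsThresholdGraph G) :
    numFaces (hansenPolytope G) = 3 ^ (n + 1) := by
  rw [numFaces_eq_ncard_exposedSubsets, ← hG.ncard_exposedSubsets_hansenPoints]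
  exact ncard_exposedSubsets_convexHull _
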